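/- Let d be odd and let A₁,…,A_N be d × d real matrices such that every convex combination Σᵢ tᵢAᵢ (with tᵢ ≥ 0 and Σᵢ tᵢ = 1) is invertible. Suppose there exists a norm |||·||| on ℝ^d such that |||x(t)||| ≤ |||x(0)||| for every trajectory x of the linear switched system defined by (A₁,…,A_N) and every t ≥ 0, and such that every vector v with |||v||| = 1 is the initial state of at least one trajectory x with |||x(t)||| = 1 for all t ≥ 0 (a Barabanov norm; such trajectories are called extremal). Then there exist two distinct extremal trajectories x ≠ y of the system with the same initial state x(0) = y(0). -/

import Mathlib

open scoped NNReal
open Filter Topology MeasureTheory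

/-- A switching law: measurable functions `u₁,…,u_N : [0,∞) → [0,1]` with `Σᵢ uᵢ(s) = 1`
for a.e. `s ≥ 0` (the `uᵢ` are extended measurably to all of `ℝ`). -/
def IsSwitchingLaw {N : ℕ} (u : Fin N → ℝ → ℝ) : Prop :=
  (∀ i, Measurable (u i)) ∧
  (∀ᵐ s ∂(volume.restrict (Set.Ici (0 : ℝ))),
    (∀ i, u i s ∈ Set.Icc (0 : ℝ) 1) ∧ ∑ i, u i s = 1)

/-- `x : [0,∞) → ℝ^d` is a trajectory of the linear switched system defined by the linear
maps `A₁,…,A_N`. -/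
def IsLinTrajectory {d N : ℕ}
    (A : Fin N → EuclideanSpace ℝ (Fin d) →L[ℝ] EuclideanSpace ℝ (Fin d))
    (x : ℝ≥0 → EuclideanSpace ℝ (Fin d)) : Prop :=
  Continuous x ∧ ∃ u : Fin N → ℝ → ℝ, IsSwitchingLaw u ∧
    ∀ t : ℝ≥0, x t = x 0 + ∫ s in Set.Ioc (0 : ℝ) (t : ℝ), ∑ i, u i s • A i (x (Real.toNNReal s))

section HairyBall

open Polynomial in
theorem even_of_eval_sq_eq_mul_one_add_sq_pow {n : ℕ} {Q : ℝ[X]} {V T : ℝ} (hT : 0 < T)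
    (hV : V ≠ 0) (hQ : ∀ t ∈ Set.Ioo 0 T, Q.eval t ^ 2 = V * (1 + t ^ 2) ^ n) : Even n := by
  have hpoly : Q ^ 2 = C V * (1 + X ^ 2) ^ n := by
    refine Polynomial.eq_of_infinite_eval_eq _ _ ((Set.Ioo_infinite hT).mono fun t ht => ?_)
    simpa using hQ t ht
  have h2 : (Q.map (algebraMap ℝ ℂ)) ^ 2 =
      (C (V : ℂ) * (X - C (-Complex.I)) ^ n) * (X - C Complex.I) ^ n := by
    have := congrArg (Polynomial.map (algebraMap ℝ ℂ)) hpoly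
    simp only [Polynomial.map_pow, Polynomial.map_mul, Polynomial.map_add, Polynomial.map_one,
      Polynomial.map_X, Polynomial.map_C, Complex.coe_algebraMap] at this
    rw [this, mul_assoc, ← mul_pow]
    congr 2
    have : C Complex.I * C Complex.I = (-1 : ℂ[X]) := by
      rw [← C_mul, Complex.I_mul_I]; simp
    simp only [map_neg]
    linear_combination this
  have hVC : (V : ℂ) ≠ 0 := by exact_mod_cast hV
  have hne : C (V : ℂ) * (X - C (-Complex.I)) ^ n ≠ 0 :=
    mul_ne_zero (by simpa using hVC) (pow_ne_zero _ (X_sub_C_ne_zero _))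
  have hroot : rootMultiplicity Complex.I (C (V : ℂ) * (X - C (-Complex.I)) ^ n) = 0 := by
    refine rootMultiplicity_eq_zero ?_
    simp only [IsRoot, eval_mul, eval_C, eval_pow, eval_sub, eval_X, sub_neg_eq_add]
    refine mul_ne_zero hVC (pow_ne_zero _ ?_)
    rw [← two_mul]
    exact mul_ne_zero two_ne_zero Complex.I_ne_zero
  have hmul := congrArg (rootMultiplicity Complex.I) h2
  rw [rootMultiplicity_mul_X_sub_C_pow hne, hroot, pow_two, rootMultiplicity_mul] at hmul
  · exact ⟨_, by simpa using hmul.symm⟩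
  · rw [← pow_two, h2]
    exact mul_ne_zero hne (pow_ne_zero _ (X_sub_C_ne_zero _))

open Polynomial in
/-- A parametric integral of polynomials of bounded degree is polynomial in the parameter. -/
theorem exists_polynomial_eval_eq_integral {α : Type*} [MeasurableSpace α] (μ : Measure α) (n : ℕ)
    (P : α → ℝ[X]) (hP : ∀ x, (P x).natDegree ≤ n) {T : ℝ} (hT : 0 < T)
    (hxint : ∀ t ∈ Set.Ioo 0 T, Integrable (fun x => (P x).eval t) μ) :
    ∃ Q : ℝ[X], ∀ t, Q.eval t = ∫ x, (P x).eval t ∂μ := by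
  obtain ⟨s, hsT, hs⟩ := (Set.Ioo_infinite hT).exists_subset_card_eq (n + 1)
  refine ⟨∑ i ∈ s, C (∫ x, (P x).eval i ∂μ) * Lagrange.basis s id i, fun t => ?_⟩
  have key : ∀ x, (P x).eval t = ∑ i ∈ s, (P x).eval i * (Lagrange.basis s id i).eval t := by
    intro x
    have := Lagrange.eq_interpolate_of_eval_eq (s := s) (v := id) (f := P x)
      (fun i => (P x).eval i) Function.injective_id.injOn
      (lt_of_le_of_lt (degree_le_of_natDegree_le (hP x))
        (by rw [hs]; exact_mod_cast n.lt_succ_self))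
      (fun i _ => rfl)
    conv_lhs => rw [this]
    simp [Lagrange.interpolate_apply, eval_finsetSum]
  simp_rw [key]
  rw [integral_finsetSum _ fun i hi => (hxint i (hsT hi)).mul_const _]
  simp [eval_finsetSum, integral_mul_const]

open Polynomial in
theorem exists_polynomial_eval_eq_det_one_add_smul {E : Type*} [NormedAddCommGroup E]
    [NormedSpace ℝ E] [FiniteDimensional ℝ E] (D : E →L[ℝ] E) :
    ∃ P : ℝ[X], P.natDegree ≤ Module.finrank ℝ E ∧
      ∀ t : ℝ, P.eval t = (ContinuousLinearMap.id ℝ E + t • D).det := by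
  classical
  let b := Module.finBasis ℝ E
  let M := LinearMap.toMatrix b b (D : E →ₗ[ℝ] E)
  refine ⟨((X : ℝ[X]) • M.map C + (1 : Matrix _ _ ℝ).map C).det, ?_, fun t => ?_⟩
  · simpa using natDegree_det_X_add_C_le M 1
  · rw [ContinuousLinearMap.det, ← LinearMap.det_toMatrix b, ← coe_evalRingHom, RingHom.map_det]
    congr 1
    ext i j
    simp [M, Matrix.one_apply, apply_ite, add_comm]
    ring

theorem det_one_add_smul_pos {E : Type*} [NormedAddCommGroup E]
    [NormedSpace ℝ E] [FiniteDimensional ℝ E] (D : E →L[ℝ] E) {t : ℝ} (ht : 0 ≤ t)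
    (h : t * ‖D‖ < 1) : 0 < (ContinuousLinearMap.id ℝ E + t • D).det := by
  have : CompleteSpace E := FiniteDimensional.complete ℝ E
  obtain ⟨P, -, hP⟩ := exists_polynomial_eval_eq_det_one_add_smul D
  have hne : ∀ s ∈ Set.Icc 0 t, P.eval s ≠ 0 := by
    intro s hs
    rw [hP]
    have hlt : ‖-(s • D)‖ < 1 := by
      rw [norm_neg, norm_smul, Real.norm_of_nonneg hs.1]
      exact (mul_le_mul_of_nonneg_right hs.2 (norm_nonneg _)).trans_lt h
    have hu := isUnit_one_sub_of_norm_lt_one hlt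
    rw [sub_neg_eq_add] at hu
    have hu' := hu.map (ContinuousLinearMap.toLinearMapRingHom : (E →L[ℝ] E) →+* (E →ₗ[ℝ] E))
    exact (LinearMap.isUnit_iff_isUnit_det _).1 hu' |>.ne_zero
  by_contra hcon
  rw [← hP] at hcon
  have h0 : P.eval 0 = 1 := by
    rw [hP]; simp [ContinuousLinearMap.det]
  obtain ⟨s, hs, hs0⟩ := intermediate_value_Icc' ht (P.continuous.continuousOn)
    (show (0 : ℝ) ∈ Set.Icc (P.eval t) (P.eval 0) from ⟨not_lt.1 hcon, by rw [h0]; norm_num⟩)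
  exact hne s hs hs0

theorem bijective_add_smul_of_lipschitz {E : Type*} [NormedAddCommGroup E] [NormedSpace ℝ E]
    [CompleteSpace E] {w : E → E} {K : ℝ≥0} (hw : LipschitzWith K w) {t : ℝ}
    (ht : |t| * K < 1) : Function.Bijective fun x => x + t • w x := by
  rcases subsingleton_or_nontrivial E with hE | hE
  · exact ⟨fun x y _ => Subsingleton.elim _ _, fun y => ⟨y, Subsingleton.elim _ _⟩⟩
  have happ : ApproximatesLinearOn (fun x => x + t • w x)
      ((ContinuousLinearEquiv.refl ℝ E : E ≃L[ℝ] E) : E →L[ℝ] E) Set.univ (‖t‖₊ * K) := by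
    intro x _ y _
    have : (x + t • w x - (y + t • w y) - (x - y)) = t • (w x - w y) := by
      rw [smul_sub]; abel
    simp only [ContinuousLinearEquiv.coe_refl, ContinuousLinearMap.coe_id', id, this, norm_smul]
    rw [NNReal.coe_mul, coe_nnnorm, mul_assoc]
    exact mul_le_mul_of_nonneg_left (hw.norm_sub_le x y) (norm_nonneg _)
  have hc : ‖t‖₊ * K < ‖((ContinuousLinearEquiv.refl ℝ E).symm : E →L[ℝ] E)‖₊⁻¹ := by
    have : ‖((ContinuousLinearEquiv.refl ℝ E).symm : E →L[ℝ] E)‖₊ = 1 := by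
      apply NNReal.eq
      simp
    rw [this, inv_one]
    exact_mod_cast ht
  exact ⟨Set.injOn_univ.1 (happ.injOn (Or.inr hc)), happ.surjective (Or.inr hc)⟩

open Metric in
theorem even_finrank_of_lipschitz_tangent_field {E : Type*} [NormedAddCommGroup E]
    [InnerProductSpace ℝ E] [FiniteDimensional ℝ E] {w : E → E} {K : ℝ≥0}
    (hw : LipschitzWith K w) (hdiff : ∀ x, x ≠ 0 → DifferentiableAt ℝ w x)
    (hinner : ∀ x, inner ℝ x (w x) = 0) (hnorm : ∀ x, ‖w x‖ = ‖x‖) :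
    Even (Module.finrank ℝ E) := by
  rcases subsingleton_or_nontrivial E with hE | hE
  · simp [Module.finrank_zero_of_subsingleton]
  let _ : MeasurableSpace E := borel E
  have : BorelSpace E := ⟨rfl⟩
  let μ : Measure E := Measure.addHaar
  set n := Module.finrank ℝ E with hn
  let S : Set E := ball 0 1 \ {0}
  have hSmeas : MeasurableSet S := measurableSet_ball.diff (measurableSet_singleton 0)
  let T : ℝ := 1 / (K + 1)
  have hT : 0 < T := by positivity
  have hTK : ∀ t ∈ Set.Ioo 0 T, t * K < 1 := fun t ht => by
    have : t * (K + 1) < 1 := by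
      have := ht.2
      rwa [lt_div_iff₀ (by positivity)] at this
    nlinarith [ht.1]
  have hbij : ∀ t ∈ Set.Ioo 0 T, Function.Bijective fun x => x + t • w x := fun t ht =>
    bijective_add_smul_of_lipschitz hw (by rw [abs_of_pos ht.1]; exact hTK t ht)
  have hsq : ∀ t x, ‖x + t • w x‖ = √(1 + t ^ 2) * ‖x‖ := by
    intro t x
    rw [← Real.sqrt_sq (norm_nonneg (x + t • w x)), ← Real.sqrt_sq (norm_nonneg x),
      ← Real.sqrt_mul (by positivity), norm_add_sq_real, inner_smul_right, hinner, norm_smul, hnorm,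
      mul_pow, Real.norm_eq_abs, sq_abs]
    congr 1
    ring
  have himage : ∀ t ∈ Set.Ioo 0 T, (fun x => x + t • w x) '' S = ball 0 (√(1 + t ^ 2)) \ {0} := by
    intro t ht
    have hpos : 0 < √(1 + t ^ 2) := by positivity
    ext y
    obtain ⟨x, rfl⟩ := (hbij t ht).2 y
    rw [(hbij t ht).1.mem_set_image]
    simp only [S, Set.mem_sdiff, mem_ball_zero_iff, Set.mem_singleton_iff, ← norm_eq_zero (E := E),
      hsq, mul_eq_zero, hpos.ne', false_or]
    rw [mul_lt_iff_lt_one_right hpos]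
  have hderiv : ∀ t : ℝ, ∀ x ∈ S, HasFDerivWithinAt (fun x => x + t • w x)
      (ContinuousLinearMap.id ℝ E + t • fderiv ℝ w x) S x := fun t x hx =>
    (HasFDerivAt.fun_add (hasFDerivAt_id x)
      ((hdiff x hx.2).hasFDerivAt.fun_const_smul t)).hasFDerivWithinAt
  choose P hPdeg hP using fun x => exists_polynomial_eval_eq_det_one_add_smul (fderiv ℝ w x)
  have hdetpos : ∀ t ∈ Set.Ioo 0 T, ∀ x,
      |(ContinuousLinearMap.id ℝ E + t • fderiv ℝ w x).det| = (P x).eval t := by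
    intro t ht x
    rw [hP, abs_of_pos]
    refine det_one_add_smul_pos _ ht.1.le (lt_of_le_of_lt ?_ (hTK t ht))
    exact mul_le_mul_of_nonneg_left (norm_fderiv_le_of_lipschitz ℝ hw) ht.1.le
  have hintegrable : ∀ t ∈ Set.Ioo 0 T, Integrable (fun x => (P x).eval t) (μ.restrict S) := by
    intro t ht
    have := (integrableOn_image_iff_integrableOn_abs_det_fderiv_smul μ hSmeas (hderiv t)
      (hbij t ht).1.injOn (fun _ => (1 : ℝ))).1 (by
        rw [himage t ht]
        exact integrableOn_const
          ((measure_mono Set.sdiff_subset).trans_lt measure_ball_lt_top).ne)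
    simpa [hdetpos t ht, IntegrableOn] using this
  obtain ⟨Q, hQ⟩ := exists_polynomial_eval_eq_integral (μ.restrict S) n P hPdeg hT hintegrable
  have hvol : ∀ t ∈ Set.Ioo 0 T, Q.eval t = √(1 + t ^ 2) ^ n * μ.real (ball 0 1) := by
    intro t ht
    have h := integral_image_eq_integral_abs_det_fderiv_smul μ hSmeas (hderiv t)
      (hbij t ht).1.injOn (fun _ => (1 : ℝ))
    simp only [hdetpos t ht, smul_eq_mul, mul_one] at h
    rw [hQ, ← h, himage t ht, setIntegral_const, smul_eq_mul, mul_one, Measure.real,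
      measure_sdiff_null (measure_singleton _), Measure.addHaar_ball μ _ (Real.sqrt_nonneg _),
      ENNReal.toReal_mul, ENNReal.toReal_ofReal (by positivity)]
    rfl
  have hV : 0 < μ.real (ball (0 : E) 1) :=
    ENNReal.toReal_pos (measure_ball_pos μ 0 one_pos).ne' measure_ball_lt_top.ne
  refine even_of_eval_sq_eq_mul_one_add_sq_pow (Q := Q) hT (pow_ne_zero 2 hV.ne') fun t ht => ?_
  rw [hvol t ht, mul_pow, ← pow_mul, mul_comm n 2, pow_mul, Real.sq_sqrt (by positivity)]
  ring

open Metric in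
theorem LipschitzOnWith.norm_smul_comp_normalize {E F : Type*} [NormedAddCommGroup E]
    [NormedSpace ℝ E] [NormedAddCommGroup F] [NormedSpace ℝ F] {v : E → F} {L : ℝ≥0}
    (hv : LipschitzOnWith L v (sphere 0 1)) (hv1 : ∀ x ∈ sphere (0 : E) 1, ‖v x‖ = 1) :
    LipschitzWith (1 + 2 * L) fun x => ‖x‖ • v (‖x‖⁻¹ • x) := by
  have hmem : ∀ x : E, x ≠ 0 → ‖x‖⁻¹ • x ∈ sphere (0 : E) 1 := fun x hx => by
    rw [mem_sphere_zero_iff_norm, norm_smul, norm_inv, norm_norm,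
      inv_mul_cancel₀ (norm_ne_zero_iff.2 hx)]
  have hnorm : ∀ x : E, ‖‖x‖ • v (‖x‖⁻¹ • x)‖ = ‖x‖ := fun x => by
    rcases eq_or_ne x 0 with rfl | hx
    · simp
    · rw [norm_smul, norm_norm, hv1 _ (hmem x hx), mul_one]
  refine LipschitzWith.of_dist_le_mul fun x y => ?_
  rw [dist_eq_norm, dist_eq_norm]
  have hK : ((1 + 2 * L : ℝ≥0) : ℝ) = 1 + 2 * L := by push_cast; rfl
  rw [hK]
  have hone : ∀ z : E, ‖z‖ ≤ (1 + 2 * L) * ‖z‖ := fun z => by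
    nlinarith [norm_nonneg z, mul_nonneg L.coe_nonneg (norm_nonneg z)]
  rcases eq_or_ne x 0 with rfl | hx
  · simpa [hnorm] using hone y
  rcases eq_or_ne y 0 with rfl | hy
  · simpa [hnorm] using hone x
  have hsplit : ‖x‖ • v (‖x‖⁻¹ • x) - ‖y‖ • v (‖y‖⁻¹ • y) =
      (‖x‖ - ‖y‖) • v (‖x‖⁻¹ • x) + ‖y‖ • (v (‖x‖⁻¹ • x) - v (‖y‖⁻¹ • y)) := by
    rw [sub_smul, smul_sub]; abel
  have hdir : ‖y‖ * ‖‖x‖⁻¹ • x - ‖y‖⁻¹ • y‖ ≤ 2 * ‖x - y‖ := by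
    have : ‖y‖ • (‖x‖⁻¹ • x - ‖y‖⁻¹ • y) = (‖y‖ - ‖x‖) • (‖x‖⁻¹ • x) + (x - y) := by
      rw [smul_sub, smul_inv_smul₀ (norm_ne_zero_iff.2 hy), sub_smul,
        smul_inv_smul₀ (norm_ne_zero_iff.2 hx)]
      abel
    calc ‖y‖ * ‖‖x‖⁻¹ • x - ‖y‖⁻¹ • y‖ = ‖(‖y‖ - ‖x‖) • (‖x‖⁻¹ • x) + (x - y)‖ := by
          rw [← this, norm_smul, norm_norm]
      _ ≤ |‖y‖ - ‖x‖| * 1 + ‖x - y‖ := by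
          refine (norm_add_le _ _).trans_eq ?_
          rw [norm_smul, mem_sphere_zero_iff_norm.1 (hmem x hx), Real.norm_eq_abs]
      _ ≤ 2 * ‖x - y‖ := by
          have := abs_norm_sub_norm_le y x
          rw [norm_sub_rev] at this
          linarith
  rw [hsplit]
  refine (norm_add_le _ _).trans ?_
  rw [norm_smul, norm_smul, hv1 _ (hmem x hx), norm_norm, Real.norm_eq_abs]
  have h1 := abs_norm_sub_norm_le x y
  have h2 := hv.norm_sub_le (hmem x hx) (hmem y hy)
  have h3 := mul_le_mul_of_nonneg_left h2 (norm_nonneg y)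
  have h4 := mul_le_mul_of_nonneg_left hdir L.coe_nonneg
  nlinarith

open Metric in
/-- A nowhere vanishing smooth tangent field on the unit sphere forces even dimension. -/
theorem even_finrank_of_contDiff_tangent_field {E : Type*} [NormedAddCommGroup E]
    [InnerProductSpace ℝ E] [FiniteDimensional ℝ E] {q : E → E} (hq : ContDiff ℝ 1 q)
    (hinner : ∀ x ∈ sphere (0 : E) 1, inner ℝ x (q x) = 0)
    (hne : ∀ x ∈ sphere (0 : E) 1, q x ≠ 0) : Even (Module.finrank ℝ E) := by
  let v : E → E := fun x => ‖q x‖⁻¹ • q x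
  have hvC : ∀ x, q x ≠ 0 → ContDiffAt ℝ 1 v x := fun x hx =>
    ((hq.contDiffAt.norm ℝ hx).inv (norm_ne_zero_iff.2 hx)).smul hq.contDiffAt
  have hv1 : ∀ x ∈ sphere (0 : E) 1, ‖v x‖ = 1 := fun x hx => by
    rw [norm_smul, norm_inv, norm_norm, inv_mul_cancel₀ (norm_ne_zero_iff.2 (hne x hx))]
  obtain ⟨L, hL⟩ : ∃ L, LipschitzOnWith L v (sphere 0 1) := by
    refine LocallyLipschitzOn.exists_lipschitzOnWith_of_compact (isCompact_sphere _ _) ?_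
    intro x hx
    obtain ⟨K, t, ht, hK⟩ := (hvC x (hne x hx)).exists_lipschitzOnWith
    exact ⟨K, t, mem_nhdsWithin_of_mem_nhds ht, hK⟩
  have hmem : ∀ x : E, x ≠ 0 → ‖x‖⁻¹ • x ∈ sphere (0 : E) 1 := fun x hx => by
    rw [mem_sphere_zero_iff_norm, norm_smul, norm_inv, norm_norm,
      inv_mul_cancel₀ (norm_ne_zero_iff.2 hx)]
  refine even_finrank_of_lipschitz_tangent_field (hL.norm_smul_comp_normalize hv1) ?_ ?_ ?_
  · intro x hx
    have hn : DifferentiableAt ℝ (fun x : E => ‖x‖) x := differentiableAt_id.norm ℝ hx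
    refine hn.smul ?_
    have h1 : DifferentiableAt ℝ v (‖x‖⁻¹ • x) :=
      (hvC _ (hne _ (hmem x hx))).differentiableAt one_ne_zero
    have h2 : DifferentiableAt ℝ (fun x : E => ‖x‖⁻¹ • x) x :=
      (hn.inv (norm_ne_zero_iff.2 hx)).smul differentiableAt_id
    exact DifferentiableAt.comp (g := v) (f := fun x : E => ‖x‖⁻¹ • x) x h1 h2
  · intro x
    rcases eq_or_ne x 0 with rfl | hx
    · simp
    · have h := hinner _ (hmem x hx)
      rw [real_inner_smul_left] at h
      have h' := (mul_eq_zero.1 h).resolve_left (inv_ne_zero (norm_ne_zero_iff.2 hx))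
      simp [v, real_inner_smul_right, h']
  · intro x
    rcases eq_or_ne x 0 with rfl | hx
    · simp
    · rw [norm_smul, norm_norm, hv1 _ (hmem x hx), mul_one]

open Metric in
/-- Hairy ball theorem: on an odd-dimensional space, every continuous map has a unit eigenvector. -/
theorem exists_norm_eq_one_and_eq_smul_of_odd_finrank {E : Type*} [NormedAddCommGroup E]
    [InnerProductSpace ℝ E] [FiniteDimensional ℝ E] (hd : Odd (Module.finrank ℝ E))
    {F : E → E} (hF : Continuous F) : ∃ x, ‖x‖ = 1 ∧ ∃ c : ℝ, F x = c • x := by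
  by_contra! hcon
  have : Nontrivial E := Module.nontrivial_of_finrank_pos (R := ℝ) hd.pos
  let tang : (E → E) → E → E := fun G x => G x - inner ℝ x (G x) • x
  have hpos : ∀ x ∈ sphere (0 : E) 1, 0 < ‖tang F x‖ := fun x hx =>
    norm_pos_iff.2 fun h => hcon x (mem_sphere_zero_iff_norm.1 hx) _ (sub_eq_zero.1 h)
  have hcont : Continuous fun x => ‖tang F x‖ := by fun_prop
  obtain ⟨x₀, hx₀, hmin⟩ := (isCompact_sphere (0 : E) 1).exists_isMinOn
    (NormedSpace.sphere_nonempty.2 zero_le_one) hcont.continuousOn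
  have hε : 0 < ‖tang F x₀‖ / 2 := half_pos (hpos x₀ hx₀)
  obtain ⟨G, hG, hGF, -⟩ := hF.exists_contDiff_approx 1 (continuous_const (y := ‖tang F x₀‖ / 2))
    fun _ => hε
  refine (Nat.not_even_iff_odd.2 hd) (even_finrank_of_contDiff_tangent_field (q := tang G) ?_ ?_ ?_)
  · exact hG.sub ((contDiff_id.inner ℝ hG).smul contDiff_id)
  · intro x hx
    simp [tang, inner_sub_right, real_inner_smul_right, mem_sphere_zero_iff_norm.1 hx]
  · intro x hx h0
    have hx1 := mem_sphere_zero_iff_norm.1 hx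
    have hdiff : tang F x = (F x - G x) - inner ℝ x (F x - G x) • x := by
      rw [← sub_zero (tang F x), ← h0]
      simp only [tang, inner_sub_right, sub_smul]
      abel
    have h1 : ‖F x - G x‖ < ‖tang F x₀‖ / 2 := by
      rw [← dist_eq_norm, dist_comm]; exact hGF x
    have h2 : |inner ℝ x (F x - G x)| ≤ ‖F x - G x‖ := by
      simpa [hx1] using abs_real_inner_le_norm x (F x - G x)
    have h3 : ‖tang F x‖ ≤ ‖F x - G x‖ + ‖F x - G x‖ := by
      rw [hdiff]
      refine (norm_sub_le _ _).trans ?_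
      rw [norm_smul, hx1, mul_one, Real.norm_eq_abs]
      gcongr
    have h4 : ‖tang F x₀‖ ≤ ‖tang F x‖ := hmin hx
    linarith

end HairyBall

section Controlled

variable {d N : ℕ} {E : Type*} [NormedAddCommGroup E] [NormedSpace ℝ E]

/-- `U i t` plays the role of `∫₀ᵗ uᵢ` for a switching law `u` generating `x`; unlike the integral
equation, these conditions are stable under pointwise limits. -/
structure IsControlled (A : Fin N → E →L[ℝ] E) (C : ℝ) (x : ℝ≥0 → E) (U : Fin N → ℝ≥0 → ℝ) :
    Prop where
  zero : ∀ i, U i 0 = 0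
  mono : ∀ i, Monotone (U i)
  sum_eq : ∀ t, ∑ i, U i t = t
  norm_sub_le : ∀ s t : ℝ≥0, s ≤ t →
    ‖x t - x s - ∑ i, (U i t - U i s) • A i (x s)‖ ≤ C * ((t : ℝ) - s) ^ 2

theorem norm_sum_smul_apply_le (A : Fin N → E →L[ℝ] E) {c : Fin N → ℝ} {r : ℝ}
    (hc : ∀ i, c i ∈ Set.Icc 0 r) (v : E) :
    ‖∑ i, c i • A i v‖ ≤ r * ((∑ i, ‖A i‖) * ‖v‖) := by
  refine (norm_sum_le _ _).trans ?_
  rw [Finset.sum_mul, Finset.mul_sum]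
  refine Finset.sum_le_sum fun i _ => ?_
  rw [norm_smul, Real.norm_of_nonneg (hc i).1]
  exact mul_le_mul (hc i).2 ((A i).le_opNorm v) (norm_nonneg _) ((hc i).1.trans (hc i).2)

theorem IsSwitchingLaw.ae_mem_uIoc {u : Fin N → ℝ → ℝ} (hu : IsSwitchingLaw u) {a b : ℝ}
    (ha : 0 ≤ a) (hab : a ≤ b) : ∀ᵐ s, s ∈ Set.uIoc a b →
      (∀ i, u i s ∈ Set.Icc (0 : ℝ) 1) ∧ ∑ i, u i s = 1 := by
  rw [Set.uIoc_of_le hab, ← ae_restrict_iff' measurableSet_Ioc]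
  exact ae_restrict_of_ae_restrict_of_subset (fun s hs => ha.trans hs.1.le) hu.2

theorem IsSwitchingLaw.intervalIntegrable {u : Fin N → ℝ → ℝ} (hu : IsSwitchingLaw u) {a b : ℝ}
    (ha : 0 ≤ a) (hab : a ≤ b) (i : Fin N) : IntervalIntegrable (u i) volume a b := by
  refine (intervalIntegrable_const (c := (1 : ℝ))).mono_fun
    (hu.1 i).aestronglyMeasurable ?_
  rw [Filter.EventuallyLE, ae_restrict_iff' measurableSet_uIoc]
  filter_upwards [hu.ae_mem_uIoc ha hab] with s hs hsI
  rw [Real.norm_of_nonneg ((hs hsI).1 i).1]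
  simpa using ((hs hsI).1 i).2

theorem IsSwitchingLaw.intervalIntegrable_sum {u : Fin N → ℝ → ℝ} (hu : IsSwitchingLaw u)
    (A : Fin N → E →L[ℝ] E) {y : ℝ → E} (hy : Continuous y) {a b : ℝ} (ha : 0 ≤ a) (hab : a ≤ b) :
    IntervalIntegrable (fun s => ∑ i, u i s • A i (y s)) volume a b := by
  have : ∀ i ∈ Finset.univ, IntervalIntegrable (fun s => u i s • A i (y s)) volume a b :=
    fun i _ => (hu.intervalIntegrable ha hab i).smul_continuousOn
      ((A i).continuous.comp hy).continuousOn
  simpa only [Finset.sum_fn] using IntervalIntegrable.sum _ this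

theorem IsSwitchingLaw.norm_integral_sub_le [CompleteSpace E] {u : Fin N → ℝ → ℝ}
    (hu : IsSwitchingLaw u)
    (A : Fin N → E →L[ℝ] E) {y : ℝ → E} (hy : Continuous y) {a b δ : ℝ} (ha : 0 ≤ a)
    (hab : a ≤ b) (hδ : ∀ s ∈ Set.Icc a b, ‖y s - y a‖ ≤ δ) :
    ‖(∫ s in a..b, ∑ i, u i s • A i (y s)) - ∑ i, (∫ s in a..b, u i s) • A i (y a)‖ ≤
      (∑ i, ‖A i‖) * δ * (b - a) := by
  have h1 : ∑ i, (∫ s in a..b, u i s) • A i (y a) = ∫ s in a..b, ∑ i, u i s • A i (y a) := by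
    rw [intervalIntegral.integral_finsetSum fun i _ =>
      (hu.intervalIntegrable ha hab i).smul_continuousOn continuousOn_const]
    exact Finset.sum_congr rfl fun i _ => (intervalIntegral.integral_smul_const _ _).symm
  rw [h1, ← intervalIntegral.integral_sub (hu.intervalIntegrable_sum A hy ha hab)
    (hu.intervalIntegrable_sum A continuous_const ha hab), ← abs_of_nonneg (sub_nonneg.2 hab)]
  refine intervalIntegral.norm_integral_le_of_norm_le_const_ae ?_
  filter_upwards [hu.ae_mem_uIoc ha hab] with s hs hsI
  rw [← Finset.sum_sub_distrib]
  simp_rw [← smul_sub, ← map_sub]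
  refine (norm_sum_smul_apply_le A (hs hsI).1 _).trans ?_
  rw [one_mul]
  rw [Set.uIoc_of_le hab] at hsI
  exact mul_le_mul_of_nonneg_left (hδ s ⟨hsI.1.le, hsI.2⟩)
    (Finset.sum_nonneg fun i _ => norm_nonneg _)

theorem IsLinTrajectory.exists_isControlled
    {A : Fin N → EuclideanSpace ℝ (Fin d) →L[ℝ] EuclideanSpace ℝ (Fin d)}
    {x : ℝ≥0 → EuclideanSpace ℝ (Fin d)} (hx : IsLinTrajectory A x) {R : ℝ}
    (hR : ∀ t, ‖x t‖ ≤ R) : ∃ U, IsControlled A ((∑ i, ‖A i‖) * ((∑ i, ‖A i‖) * R)) x U := by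
  obtain ⟨hcont, u, hu, hxint⟩ := hx
  have hM : 0 ≤ ∑ i, ‖A i‖ := Finset.sum_nonneg fun i _ => norm_nonneg _
  let y : ℝ → EuclideanSpace ℝ (Fin d) := fun s => x s.toNNReal
  have hy : Continuous y := hcont.comp continuous_real_toNNReal
  have hyint : ∀ a b : ℝ, 0 ≤ a → a ≤ b → y b - y a = ∫ s in a..b, ∑ i, u i s • A i (y s) := by
    intro a b ha hab
    have h : ∀ c, 0 ≤ c → y c = x 0 + ∫ s in 0..c, ∑ i, u i s • A i (y s) := fun c hc => by
      rw [intervalIntegral.integral_of_le hc]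
      simpa [hc] using hxint c.toNNReal
    rw [h a ha, h b (ha.trans hab), add_sub_add_left_eq_sub,
      intervalIntegral.integral_interval_sub_left]
    · exact hu.intervalIntegrable_sum A hy le_rfl (ha.trans hab)
    · exact hu.intervalIntegrable_sum A hy le_rfl ha
  have hlip : ∀ a b : ℝ, 0 ≤ a → a ≤ b → ‖y b - y a‖ ≤ (∑ i, ‖A i‖) * R * (b - a) := by
    intro a b ha hab
    rw [hyint a b ha hab, ← abs_of_nonneg (sub_nonneg.2 hab)]
    refine intervalIntegral.norm_integral_le_of_norm_le_const_ae ?_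
    filter_upwards [hu.ae_mem_uIoc ha hab] with s hs hsI
    refine (norm_sum_smul_apply_le A (hs hsI).1 _).trans ?_
    rw [one_mul]
    exact mul_le_mul_of_nonneg_left (hR _) hM
  have hUsub : ∀ i, ∀ s t : ℝ≥0, s ≤ t →
      (∫ r in (0 : ℝ)..t, u i r) - ∫ r in (0 : ℝ)..s, u i r = ∫ r in (s : ℝ)..t, u i r :=
    fun i s t _ => intervalIntegral.integral_interval_sub_left
      (hu.intervalIntegrable le_rfl t.coe_nonneg i) (hu.intervalIntegrable le_rfl s.coe_nonneg i)
  have hR0 : 0 ≤ R := (norm_nonneg _).trans (hR 0)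
  refine ⟨fun i t => ∫ r in (0 : ℝ)..t, u i r, by simp, fun i s t hst => ?_, fun t => ?_,
    fun s t hst => ?_⟩
  · rw [← sub_nonneg, hUsub i s t hst]
    refine intervalIntegral.integral_nonneg_of_ae_restrict hst ?_
    filter_upwards [ae_restrict_of_ae_restrict_of_subset
      (fun r hr => s.coe_nonneg.trans hr.1 : Set.Icc (s : ℝ) t ⊆ Set.Ici 0) hu.2] with r hr
    exact (hr.1 i).1
  · rw [← intervalIntegral.integral_finsetSum
      fun i _ => hu.intervalIntegrable le_rfl t.coe_nonneg i]
    rw [intervalIntegral.integral_congr_ae (g := fun _ => (1 : ℝ))]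
    · simp
    · filter_upwards [hu.ae_mem_uIoc le_rfl t.coe_nonneg] with s hs hsI using (hs hsI).2
  · have hst' : (s : ℝ) ≤ t := hst
    have h := hu.norm_integral_sub_le A hy s.coe_nonneg hst' (δ := (∑ i, ‖A i‖) * R * (t - s))
      fun r hr => (hlip s r s.coe_nonneg hr.1).trans
        (mul_le_mul_of_nonneg_left (by linarith [hr.2]) (mul_nonneg hM hR0))
    rw [← hyint s t s.coe_nonneg hst'] at h
    simp only [y, Real.toNNReal_coe] at h
    simp_rw [hUsub _ s t hst]
    exact h.trans_eq (by ring)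

theorem IsControlled.sub_mem_Icc {A : Fin N → E →L[ℝ] E} {C : ℝ} {x : ℝ≥0 → E}
    {U : Fin N → ℝ≥0 → ℝ} (h : IsControlled A C x U) (i : Fin N) {s t : ℝ≥0} (hst : s ≤ t) :
    U i t - U i s ∈ Set.Icc 0 ((t : ℝ) - s) := by
  have h0 : ∀ j, 0 ≤ U j t - U j s := fun j => sub_nonneg.2 (h.mono j hst)
  refine ⟨h0 i, ?_⟩
  rw [← h.sum_eq t, ← h.sum_eq s, ← Finset.sum_sub_distrib]
  exact Finset.single_le_sum (f := fun j => U j t - U j s) (fun j _ => h0 j) (Finset.mem_univ i)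

theorem IsControlled.mem_Icc {A : Fin N → E →L[ℝ] E} {C : ℝ} {x : ℝ≥0 → E}
    {U : Fin N → ℝ≥0 → ℝ} (h : IsControlled A C x U) (i : Fin N) (t : ℝ≥0) :
    U i t ∈ Set.Icc 0 (t : ℝ) := by
  simpa [h.zero] using h.sub_mem_Icc i (zero_le (a := t))

theorem IsControlled.norm_sub_le_of_bound {A : Fin N → E →L[ℝ] E} {C R : ℝ} {x : ℝ≥0 → E}
    {U : Fin N → ℝ≥0 → ℝ} (h : IsControlled A C x U) (hR : ∀ t, ‖x t‖ ≤ R) {s t : ℝ≥0}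
    (hst : s ≤ t) :
    ‖x t - x s‖ ≤ (t - s : ℝ) * ((∑ i, ‖A i‖) * R) + C * ((t : ℝ) - s) ^ 2 := by
  have h1 := norm_sum_smul_apply_le A (fun i => h.sub_mem_Icc i hst) (x s)
  have h2 : (t - s : ℝ) * ((∑ i, ‖A i‖) * ‖x s‖) ≤ (t - s : ℝ) * ((∑ i, ‖A i‖) * R) := by
    have : (0 : ℝ) ≤ t - s := sub_nonneg.2 hst
    have hM : 0 ≤ ∑ i, ‖A i‖ := Finset.sum_nonneg fun i _ => norm_nonneg _
    gcongr
    exact hR s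
  have h3 := h.norm_sub_le s t hst
  have h4 := norm_add_le (x t - x s - ∑ i, (U i t - U i s) • A i (x s))
    (∑ i, (U i t - U i s) • A i (x s))
  rw [sub_add_cancel] at h4
  linarith

theorem IsControlled.of_tendsto {α : Type*} {l : Filter α} [l.NeBot] {A : Fin N → E →L[ℝ] E}
    {C : ℝ} {y : α → ℝ≥0 → E} {V : α → Fin N → ℝ≥0 → ℝ} {x : ℝ≥0 → E} {U : Fin N → ℝ≥0 → ℝ}
    (h : ∀ᶠ z in l, IsControlled A C (y z) (V z))
    (hx : ∀ t, Tendsto (fun z => y z t) l (𝓝 (x t)))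
    (hU : ∀ i t, Tendsto (fun z => V z i t) l (𝓝 (U i t))) : IsControlled A C x U where
  zero i := tendsto_nhds_unique_of_eventuallyEq (hU i 0) tendsto_const_nhds
    (h.mono fun z hz => hz.zero i)
  mono i s t hst := le_of_tendsto_of_tendsto (hU i s) (hU i t) (h.mono fun z hz => hz.mono i hst)
  sum_eq t := tendsto_nhds_unique_of_eventuallyEq (tendsto_finsetSum _ fun i _ => hU i t)
    tendsto_const_nhds (h.mono fun z hz => hz.sum_eq t)
  norm_sub_le s t hst := by
    refine le_of_tendsto ((((hx t).sub (hx s)).sub (tendsto_finsetSum _ fun i _ => ?_)).norm)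
      (h.mono fun z hz => hz.norm_sub_le s t hst)
    exact ((hU i t).sub (hU i s)).smul (((A i).continuous.tendsto _).comp (hx s))

theorem exists_isControlled_of_ultrafilter [FiniteDimensional ℝ E] {α : Type*} (g : Ultrafilter α)
    {A : Fin N → E →L[ℝ] E} {C R : ℝ} {y : α → ℝ≥0 → E} {V : α → Fin N → ℝ≥0 → ℝ}
    (h : ∀ᶠ z in (g : Filter α), IsControlled A C (y z) (V z))
    (hR : ∀ᶠ z in (g : Filter α), ∀ t, ‖y z t‖ ≤ R) :
    ∃ x U, IsControlled A C x U ∧ (∀ t, ‖x t‖ ≤ R) ∧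
      ∀ t, Tendsto (fun z => y z t) g (𝓝 (x t)) := by
  have : ProperSpace E := FiniteDimensional.proper ℝ E
  have hx : ∀ t, ∃ v ∈ Metric.closedBall (0 : E) R, Tendsto (fun z => y z t) g (𝓝 v) := fun t =>
    isCompact_iff_ultrafilter_le_nhds'.1 (isCompact_closedBall (0 : E) R) (g.map fun z => y z t)
      (hR.mono fun z hz => mem_closedBall_zero_iff.2 (hz t))
  have hU : ∀ i (t : ℝ≥0), ∃ v ∈ Set.Icc 0 (t : ℝ), Tendsto (fun z => V z i t) g (𝓝 v) := fun i t =>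
    isCompact_iff_ultrafilter_le_nhds'.1 isCompact_Icc (g.map fun z => V z i t)
      (h.mono fun z hz => hz.mem_Icc i t)
  choose x hxR hx using hx
  choose U hUR hU using hU
  exact ⟨x, U, .of_tendsto h hx hU, fun t => mem_closedBall_zero_iff.1 (hxR t), hx⟩

theorem IsControlled.continuous {A : Fin N → E →L[ℝ] E} {C R : ℝ} {x : ℝ≥0 → E}
    {U : Fin N → ℝ≥0 → ℝ} (h : IsControlled A C x U) (hR : ∀ t, ‖x t‖ ≤ R) : Continuous x := by
  let b : ℝ → ℝ := fun r => r * ((∑ i, ‖A i‖) * R) + C * r ^ 2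
  have hb : ∀ s t, dist (x s) (x t) ≤ b (dist s t) := by
    intro s t
    wlog hst : s ≤ t generalizing s t
    · rw [dist_comm, dist_comm s t]
      exact this t s (le_of_not_ge hst)
    have hd : dist s t = (t : ℝ) - s := by
      rw [dist_comm, NNReal.dist_eq, abs_of_nonneg (sub_nonneg.2 (NNReal.coe_le_coe.2 hst))]
    rw [dist_comm, dist_eq_norm, hd]
    exact h.norm_sub_le_of_bound hR hst
  refine continuous_iff_continuousAt.2 fun t => tendsto_iff_dist_tendsto_zero.2 ?_
  refine squeeze_zero (fun _ => dist_nonneg) (fun s => hb s t) ?_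
  have hcont : Continuous fun s => b (dist s t) := by fun_prop
  simpa [b] using hcont.tendsto t

theorem IsControlled.exists_isSwitchingLaw {A : Fin N → E →L[ℝ] E} {C : ℝ} {x : ℝ≥0 → E}
    {U : Fin N → ℝ≥0 → ℝ} (h : IsControlled A C x U) :
    ∃ u : Fin N → ℝ → ℝ, IsSwitchingLaw u ∧
      ∀ i, ∀ s t : ℝ≥0, s ≤ t → ∫ r in (s : ℝ)..t, u i r = U i t - U i s := by
  let W : Fin N → ℝ → ℝ := fun i r => U i r.toNNReal
  have hmono : ∀ i, Monotone (W i) := fun i =>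
    (h.mono i).comp (fun _ _ hab => Real.toNNReal_mono hab)
  have hUlip : ∀ i, LipschitzWith 1 (U i) := fun i => by
    refine LipschitzWith.of_dist_le_mul fun s t => ?_
    wlog hst : t ≤ s generalizing s t
    · rw [dist_comm, dist_comm s t]
      exact this t s (le_of_not_ge hst)
    rw [NNReal.coe_one, one_mul, Real.dist_eq, NNReal.dist_eq,
      abs_of_nonneg (h.sub_mem_Icc i hst).1, abs_of_nonneg (sub_nonneg.2 (NNReal.coe_le_coe.2 hst))]
    exact (h.sub_mem_Icc i hst).2
  have hlip : ∀ i, LipschitzWith 1 (W i) := fun i => by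
    have := (hUlip i).comp Real.lipschitzWith_toNNReal
    rwa [one_mul] at this
  refine ⟨fun i => deriv (W i), ⟨fun i => measurable_deriv _, ?_⟩, fun i s t hst => ?_⟩
  · have hpos : ∀ᵐ s ∂(volume.restrict (Set.Ici (0 : ℝ))), s ∈ Set.Ioi (0 : ℝ) := by
      rw [← restrict_Ioi_eq_restrict_Ici]
      exact ae_restrict_mem measurableSet_Ioi
    have hdiff : ∀ᵐ s ∂(volume.restrict (Set.Ici (0 : ℝ))), ∀ i, DifferentiableAt ℝ (W i) s :=
      ae_restrict_of_ae (ae_all_iff.2 fun i => (hmono i).ae_differentiableAt)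
    filter_upwards [hpos, hdiff] with s hs hds
    refine ⟨fun i => ⟨(hmono i).deriv_nonneg, ?_⟩, ?_⟩
    · simpa using (le_abs_self _).trans (norm_deriv_le_of_lipschitz (hlip i) (x₀ := s))
    · rw [← deriv_fun_sum fun i _ => hds i]
      have : (fun r => ∑ i, W i r) =ᶠ[𝓝 s] id := by
        filter_upwards [lt_mem_nhds hs] with r hr
        simp [W, h.sum_eq, hr.le]
      rw [this.deriv_eq, deriv_id]
  · have := ((hlip i).lipschitzOnWith (s := Set.uIcc (s : ℝ) t)
      ).absolutelyContinuousOnInterval.integral_deriv_eq_sub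
    simpa [W] using this

theorem IsControlled.isLinTrajectory
    {A : Fin N → EuclideanSpace ℝ (Fin d) →L[ℝ] EuclideanSpace ℝ (Fin d)} {C R : ℝ}
    {x : ℝ≥0 → EuclideanSpace ℝ (Fin d)} {U : Fin N → ℝ≥0 → ℝ} (h : IsControlled A C x U)
    (hR : ∀ t, ‖x t‖ ≤ R) : IsLinTrajectory A x := by
  obtain ⟨u, hu, hUint⟩ := h.exists_isSwitchingLaw
  refine ⟨h.continuous hR, u, hu, fun T => ?_⟩
  let y : ℝ → EuclideanSpace ℝ (Fin d) := fun s => x s.toNNReal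
  have hy : Continuous y := (h.continuous hR).comp continuous_real_toNNReal
  let f : ℝ → EuclideanSpace ℝ (Fin d) := fun s => ∑ i, u i s • A i (y s)
  let z : ℝ → EuclideanSpace ℝ (Fin d) := fun r => y r - ∫ s in 0..r, f s
  have hM : 0 ≤ ∑ i, ‖A i‖ := Finset.sum_nonneg fun i _ => norm_nonneg _
  have hR0 : 0 ≤ R := (norm_nonneg _).trans (hR 0)
  have hC : 0 ≤ C := by simpa using (norm_nonneg _).trans (h.norm_sub_le 0 1 zero_le_one)
  have hquad : ∀ a b : ℝ, 0 ≤ a → a ≤ b → b ≤ T →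
      ‖z b - z a‖ ≤ (C + (∑ i, ‖A i‖) * ((∑ i, ‖A i‖) * R + C * T)) * (b - a) ^ 2 := by
    intro a b ha hab hbT
    lift a to ℝ≥0 using ha
    lift b to ℝ≥0 using a.coe_nonneg.trans hab
    have hab' : a ≤ b := hab
    have hδ : ∀ s ∈ Set.Icc (a : ℝ) b,
        ‖y s - y a‖ ≤ ((∑ i, ‖A i‖) * R + C * T) * (b - a) := by
      intro s hs
      lift s to ℝ≥0 using a.coe_nonneg.trans hs.1
      have h1 := h.norm_sub_le_of_bound hR (s := a) (t := s) hs.1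
      simp only [y, Real.toNNReal_coe]
      refine h1.trans ?_
      have h2 : (0 : ℝ) ≤ s - a := sub_nonneg.2 hs.1
      have h3 : (s : ℝ) - a ≤ b - a := sub_le_sub_right hs.2 _
      have h4 : (s : ℝ) - a ≤ T := by linarith [hs.2, a.coe_nonneg]
      calc (s - a : ℝ) * ((∑ i, ‖A i‖) * R) + C * ((s : ℝ) - a) ^ 2
          = ((∑ i, ‖A i‖) * R + C * (s - a)) * (s - a) := by ring
        _ ≤ _ := by gcongr
    have h1 := hu.norm_integral_sub_le A hy a.coe_nonneg hab hδ
    simp_rw [hUint _ a b hab'] at h1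
    have h2 := h.norm_sub_le a b hab'
    have hz : z b - z a = (x b - x a - ∑ i, (U i b - U i a) • A i (x a)) -
        ((∫ s in (a : ℝ)..b, f s) - ∑ i, (U i b - U i a) • A i (x a)) := by
      have : (∫ s in (0 : ℝ)..b, f s) - ∫ s in (0 : ℝ)..a, f s = ∫ s in (a : ℝ)..b, f s :=
        intervalIntegral.integral_interval_sub_left
          (hu.intervalIntegrable_sum A hy le_rfl b.coe_nonneg)
          (hu.intervalIntegrable_sum A hy le_rfl a.coe_nonneg)
      rw [← this]
      simp only [z, y, Real.toNNReal_coe]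
      abel
    rw [hz]
    simp only [y, Real.toNNReal_coe] at h1
    refine (_root_.norm_sub_le _ _).trans ((add_le_add h2 h1).trans_eq ?_)
    ring
  have hderiv : ∀ a ∈ Set.Ico (0 : ℝ) T, HasDerivWithinAt z 0 (Set.Ici a) a := by
    intro a ha
    rw [hasDerivWithinAt_iff_isLittleO]
    have hO : (fun b => z b - z a - (b - a) • (0 : EuclideanSpace ℝ (Fin d))) =O[𝓝[≥] a]
        fun b => (b - a) ^ 2 := by
      refine Asymptotics.IsBigO.of_bound (C + (∑ i, ‖A i‖) * ((∑ i, ‖A i‖) * R + C * T)) ?_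
      filter_upwards [self_mem_nhdsWithin, mem_nhdsWithin_of_mem_nhds (gt_mem_nhds ha.2)]
        with b hb hbT
      simpa using hquad a b ha.1 hb hbT.le
    refine hO.trans_isLittleO ?_
    have : (fun b : ℝ => (b - a) ^ 2) =o[𝓝 a] fun b => b - a := by
      simpa using Asymptotics.isLittleO_pow_sub_sub a one_lt_two
    exact this.mono nhdsWithin_le_nhds
  have hcont : ContinuousOn z (Set.Icc 0 T) := by
    refine hy.continuousOn.sub ?_
    have := intervalIntegral.continuousOn_primitive_interval' (μ := volume)
      (hu.intervalIntegrable_sum A hy le_rfl T.coe_nonneg) Set.left_mem_uIcc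
    rwa [Set.uIcc_of_le T.coe_nonneg] at this
  have hfin := constant_of_has_deriv_right_zero hcont hderiv T ⟨T.coe_nonneg, le_rfl⟩
  simp only [z, intervalIntegral.integral_same, sub_zero] at hfin
  rw [intervalIntegral.integral_of_le T.coe_nonneg, sub_eq_iff_eq_add] at hfin
  simpa [y, f] using hfin

theorem IsLinTrajectory.exists_tendsto_of_ultrafilter
    {A : Fin N → EuclideanSpace ℝ (Fin d) →L[ℝ] EuclideanSpace ℝ (Fin d)} {α : Type*}
    (g : Ultrafilter α) {y : α → ℝ≥0 → EuclideanSpace ℝ (Fin d)} {R : ℝ}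
    (h : ∀ᶠ z in (g : Filter α), IsLinTrajectory A (y z) ∧ ∀ t, ‖y z t‖ ≤ R) :
    ∃ x, IsLinTrajectory A x ∧ ∀ t, Tendsto (fun z => y z t) g (𝓝 (x t)) := by
  have hV : ∀ z, ∃ V, (IsLinTrajectory A (y z) ∧ ∀ t, ‖y z t‖ ≤ R) →
      IsControlled A ((∑ i, ‖A i‖) * ((∑ i, ‖A i‖) * R)) (y z) V := fun z => by
    by_cases hz : IsLinTrajectory A (y z) ∧ ∀ t, ‖y z t‖ ≤ R
    · obtain ⟨V, hV⟩ := hz.1.exists_isControlled hz.2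
      exact ⟨V, fun _ => hV⟩
    · exact ⟨0, fun h => absurd h hz⟩
  choose V hV using hV
  obtain ⟨x, U, hxU, hxR, hx⟩ :=
    exists_isControlled_of_ultrafilter g (h.mono hV) (h.mono fun z hz => hz.2)
  exact ⟨x, hxU.isLinTrajectory hxR, hx⟩

theorem IsLinTrajectory.const_smul
    {A : Fin N → EuclideanSpace ℝ (Fin d) →L[ℝ] EuclideanSpace ℝ (Fin d)}
    {x : ℝ≥0 → EuclideanSpace ℝ (Fin d)} (hx : IsLinTrajectory A x) (c : ℝ) :
    IsLinTrajectory A fun t => c • x t := by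
  obtain ⟨hcont, u, hu, hxint⟩ := hx
  refine ⟨hcont.const_smul c, u, hu, fun t => ?_⟩
  simp only [map_smul, smul_comm _ c, ← Finset.smul_sum]
  rw [integral_smul, ← smul_add, ← hxint t]

theorem IsControlled.ne_and_ne_neg {A : Fin N → E →L[ℝ] E} {C c₀ : ℝ} {x : ℝ≥0 → E}
    {U : Fin N → ℝ≥0 → ℝ} (h : IsControlled A C x U)
    (hc₀ : ∀ w ∈ stdSimplex ℝ (Fin N), ∀ v : E, ‖v‖ = 1 → c₀ ≤ ‖∑ i, w i • A i v‖)
    (hx : ‖x 0‖ = 1) {t : ℝ≥0} (ht : 0 < t) (htC : C * t < c₀)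
    (ht2 : t * (∑ i, ‖A i‖) + C * t ^ 2 < 2) : x t ≠ x 0 ∧ x t ≠ -x 0 := by
  have ht' : (0 : ℝ) < t := ht
  have h1 := h.norm_sub_le 0 t zero_le
  simp only [h.zero, sub_zero, NNReal.coe_zero] at h1
  refine ⟨fun hxt => ?_, fun hxt => ?_⟩
  · have hw : (fun i => (t : ℝ)⁻¹ * U i t) ∈ stdSimplex ℝ (Fin N) :=
      ⟨fun i => mul_nonneg (inv_nonneg.2 ht'.le) (h.mem_Icc i t).1, by
        rw [← Finset.mul_sum, h.sum_eq, inv_mul_cancel₀ ht'.ne']⟩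
    have h2 := hc₀ _ hw _ hx
    simp only [mul_smul, ← Finset.smul_sum] at h2
    rw [norm_smul, norm_inv, Real.norm_of_nonneg ht'.le, inv_mul_eq_div, le_div_iff₀ ht'] at h2
    rw [hxt, sub_self, zero_sub, norm_neg] at h1
    nlinarith
  · have h2 := norm_sum_smul_apply_le A (fun i => h.mem_Icc i t) (x 0)
    have h3 : (2 : ℝ) = ‖x t - x 0‖ := by
      rw [hxt, show -x 0 - x 0 = (-2 : ℝ) • x 0 by module, norm_smul, hx]
      norm_num
    have h4 := norm_add_le (x t - x 0 - ∑ i, U i t • A i (x 0)) (∑ i, U i t • A i (x 0))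
    rw [sub_add_cancel, ← h3] at h4
    rw [hx, mul_one] at h2
    linarith

end Controlled

section Norm

variable {E : Type*} [NormedAddCommGroup E] [NormedSpace ℝ E] [FiniteDimensional ℝ E]

theorem exists_pos_forall_mem_le_norm {X F : Type*} [TopologicalSpace X] [NormedAddCommGroup F]
    {s : Set X} (hs : IsCompact s) {f : X → F} (hf : ContinuousOn f s) (h0 : ∀ x ∈ s, f x ≠ 0) :
    ∃ c : ℝ, 0 < c ∧ ∀ x ∈ s, c ≤ ‖f x‖ := by
  rcases s.eq_empty_or_nonempty with rfl | hne
  · exact ⟨1, one_pos, by simp⟩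
  · obtain ⟨x, hx, hmin⟩ := hs.exists_isMinOn hne hf.norm
    exact ⟨‖f x‖, norm_pos_iff.2 (h0 x hx), fun y hy => hmin hy⟩

theorem exists_pos_forall_mem_stdSimplex_le_norm {N : ℕ} {A : Fin N → E →L[ℝ] E}
    (hinv : ∀ w ∈ stdSimplex ℝ (Fin N), Function.Injective fun v => ∑ i, w i • A i v) :
    ∃ c₀ : ℝ, 0 < c₀ ∧
      ∀ w ∈ stdSimplex ℝ (Fin N), ∀ v : E, ‖v‖ = 1 → c₀ ≤ ‖∑ i, w i • A i v‖ := by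
  have : ProperSpace E := FiniteDimensional.proper ℝ E
  obtain ⟨c, hc, h⟩ := exists_pos_forall_mem_le_norm
    ((isCompact_stdSimplex ℝ (Fin N)).prod (isCompact_sphere (0 : E) 1))
    (f := fun q => ∑ i, q.1 i • A i q.2) (by fun_prop) fun q hq h0 => by
      have : q.2 = 0 := hinv q.1 hq.1 (by simpa using h0)
      simpa [this] using hq.2
  exact ⟨c, hc, fun w hw v hv => h (w, v) ⟨hw, by simpa using hv⟩⟩

theorem Seminorm.continuous_of_finiteDimensional (p : Seminorm ℝ E) : Continuous p :=
  p.convexOn.locallyLipschitz.continuous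

theorem Seminorm.exists_pos_mul_norm_le (p : Seminorm ℝ E) (hp : ∀ v, p v = 0 → v = 0) :
    ∃ c : ℝ, 0 < c ∧ ∀ v, c * ‖v‖ ≤ p v := by
  have : ProperSpace E := FiniteDimensional.proper ℝ E
  obtain ⟨c, hc, h⟩ := exists_pos_forall_mem_le_norm (isCompact_sphere (0 : E) 1)
    (f := p) p.continuous_of_finiteDimensional.continuousOn
    fun v hv h0 => by simp [hp v h0] at hv
  refine ⟨c, hc, fun v => ?_⟩
  rcases eq_or_ne v 0 with rfl | hv
  · simp
  · have := h (‖v‖⁻¹ • v) (by simp [norm_smul, hv])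
    rw [map_smul_eq_mul, norm_inv, norm_norm, Real.norm_of_nonneg (by positivity), inv_mul_eq_div,
      le_div_iff₀ (norm_pos_iff.2 hv)] at this
    exact this

end Norm

theorem continuous_flow_of_unique {d N : ℕ}
    {A : Fin N → EuclideanSpace ℝ (Fin d) →L[ℝ] EuclideanSpace ℝ (Fin d)}
    {p : Seminorm ℝ (EuclideanSpace ℝ (Fin d))} (hp : ∀ v, p v = 0 → v = 0)
    {Φ : EuclideanSpace ℝ (Fin d) → ℝ≥0 → EuclideanSpace ℝ (Fin d)}
    (hΦ : ∀ v, IsLinTrajectory A (Φ v)) (hΦ0 : ∀ v, Φ v 0 = v) (hΦp : ∀ v t, p (Φ v t) = p v)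
    (huniq : ∀ v x, IsLinTrajectory A x → x 0 = v → (∀ t, p (x t) = p v) → x = Φ v) (t : ℝ≥0) :
    Continuous fun v => Φ v t := by
  obtain ⟨c, hc, hcp⟩ := p.exists_pos_mul_norm_le hp
  have hpc : Continuous p := p.continuous_of_finiteDimensional
  refine continuous_iff_continuousAt.2 fun v => tendsto_iff_ultrafilter _ _ _ |>.2 fun g hg => ?_
  have hb : ∀ᶠ z in (g : Filter _), IsLinTrajectory A (Φ z) ∧ ∀ t, ‖Φ z t‖ ≤ (p v + 1) / c := by
    filter_upwards [hg (hpc.continuousAt.eventually_lt_const (lt_add_one (p v)))] with z hz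
    refine ⟨hΦ z, fun t => ?_⟩
    rw [le_div_iff₀ hc, mul_comm]
    exact (hcp _).trans ((hΦp z t).trans_le hz.le)
  obtain ⟨x, hx, hlim⟩ := IsLinTrajectory.exists_tendsto_of_ultrafilter g hb
  have hx0 : x 0 = v := tendsto_nhds_unique (hlim 0) (by simpa [hΦ0, Tendsto] using hg)
  have hxp : ∀ t, p (x t) = p v := fun t =>
    tendsto_nhds_unique ((hpc.tendsto _).comp (hlim t))
      (by simpa [Function.comp_def, hΦp] using (hpc.tendsto v).mono_left hg)
  simpa only [huniq v x hx hx0 hxp] using hlim t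

theorem exists_pos_forall_extremal_ne {d N : ℕ}
    {A : Fin N → EuclideanSpace ℝ (Fin d) →L[ℝ] EuclideanSpace ℝ (Fin d)}
    (hinv : ∀ w ∈ stdSimplex ℝ (Fin N), Function.Injective fun v => ∑ i, w i • A i v)
    {p : Seminorm ℝ (EuclideanSpace ℝ (Fin d))} (hp : ∀ v, p v = 0 → v = 0) :
    ∃ t : ℝ≥0, ∀ x, IsLinTrajectory A x → (∀ s, p (x s) = p (x 0)) → ‖x 0‖ = 1 →
      x t ≠ x 0 ∧ x t ≠ -x 0 := by
  obtain ⟨c, hc, hcp⟩ := p.exists_pos_mul_norm_le hp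
  obtain ⟨c₀, hc₀, hA⟩ := exists_pos_forall_mem_stdSimplex_le_norm hinv
  obtain ⟨K, hK⟩ := (isCompact_sphere (0 : EuclideanSpace ℝ (Fin d)) 1).exists_bound_of_continuousOn
    p.continuous_of_finiteDimensional.continuousOn
  set C := (∑ i, ‖A i‖) * ((∑ i, ‖A i‖) * (K / c)) with hC
  have h1 : ∀ᶠ t : ℝ in 𝓝[>] 0, C * t < c₀ := by
    have : Tendsto (fun t : ℝ => C * t) (𝓝 0) (𝓝 (C * 0)) := Continuous.tendsto (by fun_prop) 0
    exact nhdsWithin_le_nhds (this.eventually_lt_const (by simpa using hc₀))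
  have h2 : ∀ᶠ t : ℝ in 𝓝[>] 0, t * (∑ i, ‖A i‖) + C * t ^ 2 < 2 := by
    have : Tendsto (fun t : ℝ => t * (∑ i, ‖A i‖) + C * t ^ 2) (𝓝 0)
      (𝓝 (0 * (∑ i, ‖A i‖) + C * 0 ^ 2)) := Continuous.tendsto (by fun_prop) 0
    exact nhdsWithin_le_nhds (this.eventually_lt_const (by simp))
  obtain ⟨t, ⟨ht1, ht2⟩, ht⟩ := ((h1.and h2).and self_mem_nhdsWithin).exists
  lift t to ℝ≥0 using le_of_lt ht
  refine ⟨t, fun x hx hxp hx0 => ?_⟩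
  have hR : ∀ s, ‖x s‖ ≤ K / c := fun s => by
    rw [le_div_iff₀ hc, mul_comm]
    exact (hcp _).trans ((hxp s).trans_le ((le_abs_self _).trans (hK _ (by simpa using hx0))))
  obtain ⟨U, hU⟩ := hx.exists_isControlled hR
  exact hU.ne_and_ne_neg hA hx0 (NNReal.coe_pos.1 ht) ht1 ht2

/-- Non-uniqueness of extremal trajectories: if `d` is odd, every convex combination of
`A₁,…,A_N` is invertible, and `ν` is a Barabanov norm for the system, then some two
distinct extremal trajectories share their initial state. -/
theorem barabanov_extremal_trajectories_not_unique
    (d N : ℕ) (hd : Odd d)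
    (A : Fin N → EuclideanSpace ℝ (Fin d) →L[ℝ] EuclideanSpace ℝ (Fin d))
    (hinv : ∀ c : Fin N → ℝ, (∀ i, 0 ≤ c i) → ∑ i, c i = 1 →
      Function.Bijective (fun v => ∑ i, c i • A i v))
    (ν : EuclideanSpace ℝ (Fin d) → ℝ)
    (hν₀ : ∀ v, ν v = 0 → v = 0)
    (hνsmul : ∀ (c : ℝ) (v), ν (c • v) = |c| * ν v)
    (hνadd : ∀ v w, ν (v + w) ≤ ν v + ν w)
    (hmono : ∀ x : ℝ≥0 → EuclideanSpace ℝ (Fin d), IsLinTrajectory A x →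
      ∀ t : ℝ≥0, ν (x t) ≤ ν (x 0))
    (hext : ∀ v : EuclideanSpace ℝ (Fin d), ν v = 1 →
      ∃ x : ℝ≥0 → EuclideanSpace ℝ (Fin d), IsLinTrajectory A x ∧ x 0 = v ∧
        ∀ t : ℝ≥0, ν (x t) = 1) :
    ∃ x y : ℝ≥0 → EuclideanSpace ℝ (Fin d),
      IsLinTrajectory A x ∧ IsLinTrajectory A y ∧
      (∀ t : ℝ≥0, ν (x t) = 1) ∧ (∀ t : ℝ≥0, ν (y t) = 1) ∧
      x 0 = y 0 ∧ ∃ t : ℝ≥0, x t ≠ y t := by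
  by_contra hcon
  push Not at hcon
  let p : Seminorm ℝ (EuclideanSpace ℝ (Fin d)) := Seminorm.of ν hνadd hνsmul
  have hνnn : ∀ v, 0 ≤ ν v := apply_nonneg p
  have hscale : ∀ v, ν v ≠ 0 → ∀ w, ν w = ν v → ν ((ν v)⁻¹ • w) = 1 := by
    intro v hv w hw
    rw [hνsmul, abs_of_nonneg (inv_nonneg.2 (hνnn v)), hw, inv_mul_cancel₀ hv]
  have hex : ∀ v, ∃ x : ℝ≥0 → EuclideanSpace ℝ (Fin d), IsLinTrajectory A x ∧ x 0 = v ∧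
      ∀ t, ν (x t) = ν v := by
    have : Nontrivial (EuclideanSpace ℝ (Fin d)) :=
      Module.nontrivial_of_finrank_pos (R := ℝ) (by simpa using hd.pos)
    obtain ⟨w₀, hw₀⟩ := exists_ne (0 : EuclideanSpace ℝ (Fin d))
    have hpolar : ∀ v, ∃ w, ν w = 1 ∧ ν v • w = v := fun v => by
      by_cases hv : ν v = 0
      · exact ⟨(ν w₀)⁻¹ • w₀, hscale _ (mt (hν₀ _) hw₀) _ rfl, by rw [hv, zero_smul, hν₀ v hv]⟩
      · exact ⟨(ν v)⁻¹ • v, hscale _ hv _ rfl, smul_inv_smul₀ hv v⟩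
    intro v
    obtain ⟨w, hw, hwv⟩ := hpolar v
    obtain ⟨x, hx, hx0, hxν⟩ := hext w hw
    exact ⟨_, hx.const_smul (ν v), by rw [hx0, hwv], fun t => by
      rw [hνsmul, hxν, mul_one, abs_of_nonneg (hνnn v)]⟩
  choose Φ hΦ hΦ0 hΦν using hex
  have huniq : ∀ v x, IsLinTrajectory A x → x 0 = v → (∀ t, ν (x t) = ν v) → x = Φ v := by
    intro v x hx hx0 hxν
    funext t
    by_cases hv : ν v = 0
    · rw [hν₀ _ ((hxν t).trans hv), hν₀ _ ((hΦν v t).trans hv)]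
    · have := hcon _ _ (hx.const_smul (ν v)⁻¹) ((hΦ v).const_smul (ν v)⁻¹)
        (fun t => hscale v hv _ (hxν t)) (fun t => hscale v hv _ (hΦν v t))
        (by rw [hx0, hΦ0]) t
      exact smul_right_injective _ (inv_ne_zero hv) this
  obtain ⟨t, ht⟩ := exists_pos_forall_extremal_ne
    (fun w hw => (hinv w hw.1 hw.2).injective) (p := p) hν₀
  have hcont := continuous_flow_of_unique (p := p) hν₀ hΦ hΦ0 hΦν huniq t
  obtain ⟨v, hv, c, hc⟩ := exists_norm_eq_one_and_eq_smul_of_odd_finrank (by simpa using hd) hcont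
  have hv0 : v ≠ 0 := by
    rintro rfl
    simp at hv
  have hc1 : |c| = 1 := by
    have := hΦν v t
    rw [hc, hνsmul] at this
    exact mul_right_cancel₀ (mt (hν₀ v) hv0) (this.trans (one_mul _).symm)
  have hne := ht (Φ v) (hΦ v) (fun s => by
    rw [hΦ0]
    exact hΦν v s) (by rw [hΦ0, hv])
  rw [hΦ0, hc] at hne
  rcases (abs_eq zero_le_one).1 hc1 with rfl | rfl
  · exact hne.1 (one_smul _ _)
  · exact hne.2 (by simp)
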